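/- arXiv:1205.3697 — 2 statements merged into one kernel-verified Lean document; each statement's English description precedes it below -/
import Mathlib

section
/- Let β > 1 and let v : (0,∞) × (0,∞) → ℝ be a smooth function with values in (0,π) satisfying ∂ₜv = ∂ᵣᵣv + (1/r)∂ᵣv. Define ψ(t,r) = arccos(√((β−1)/β) · cos v(t,r)). Then ψ takes values in (0,π) with β sin²ψ(t,r) > 1 for all (t,r), and ψ satisfies the nonlinear heat equation ∂ₜψ = ∂ᵣᵣψ + (1/r)∂ᵣψ − (cos ψ /((β sin²ψ − 1) sin ψ)) (∂ᵣψ)². -/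
open Real Set

lemma one_sub_mul_cos_sq_pos {k : ℝ} (hk : k ^ 2 < 1) (x : ℝ) : 0 < 1 - (k * cos x) ^ 2 := by
  nlinarith [sin_sq_add_cos_sq x, sq_nonneg (k * sin x)]

lemma hasDerivAt_arccos_mul_cos {k : ℝ} (hk : k ^ 2 < 1) {f : ℝ → ℝ} {f' x : ℝ}
    (hf : HasDerivAt f f' x) :
    HasDerivAt (fun y => arccos (k * cos (f y)))
      (k * sin (f x) / √(1 - (k * cos (f x)) ^ 2) * f') x := by
  have hpos := one_sub_mul_cos_sq_pos hk (f x)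
  have h1 : k * cos (f x) ≠ -1 := fun h => by rw [h] at hpos; norm_num at hpos
  have h2 : k * cos (f x) ≠ 1 := fun h => by rw [h] at hpos; norm_num at hpos
  refine ((hasDerivAt_arccos h1 h2).comp x (hf.cos.const_mul k)).congr_deriv ?_
  ring

lemma hasDerivAt_mul_sin_div_sqrt {k : ℝ} (hk : k ^ 2 < 1) {f : ℝ → ℝ} {f' x : ℝ}
    (hf : HasDerivAt f f' x) :
    HasDerivAt (fun y => k * sin (f y) / √(1 - (k * cos (f y)) ^ 2))
      (k * cos (f x) * (1 - k ^ 2) / √(1 - (k * cos (f x)) ^ 2) ^ 3 * f') x := by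
  have hpos := one_sub_mul_cos_sq_pos hk (f x)
  have hS := Real.sqrt_pos.2 hpos
  have hSS := Real.sq_sqrt hpos.le
  have hs := (((hf.cos.const_mul k).fun_pow 2).const_sub 1).sqrt hpos.ne'
  refine ((hf.sin.const_mul k).fun_div hs hS.ne').congr_deriv ?_
  set S := √(1 - (k * cos (f x)) ^ 2)
  push_cast
  field_simp
  rw [hSS]
  linear_combination -k ^ 3 * f' * cos (f x) * sin_sq_add_cos_sq (f x)

/-- Conversely, if `v` solves the linear radial heat equation
with values in `(0,π)`, then `ψ = arccos(√((β−1)/β) cos v)` takes values in `(0,π)`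
with `β sin²ψ > 1` and solves the nonlinear heat equation
`∂ₜψ = ∂ᵣᵣψ + (1/r)∂ᵣψ − (cos ψ /((β sin²ψ − 1) sin ψ))(∂ᵣψ)²`. -/
theorem inverse_hopf_cole
    (β : ℝ) (hβ : 1 < β)
    (v : ℝ → ℝ → ℝ)
    (hv_smooth : ContDiffOn ℝ (⊤ : ℕ∞) (fun q : ℝ × ℝ => v q.1 q.2) (Ioi 0 ×ˢ Ioi 0))
    (hv_range : ∀ t ∈ Ioi (0:ℝ), ∀ r ∈ Ioi (0:ℝ), v t r ∈ Ioo 0 π)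
    (hv_eq : ∀ t ∈ Ioi (0:ℝ), ∀ r ∈ Ioi (0:ℝ),
      deriv (fun s => v s r) t
        = deriv (deriv (v t)) r + (1/r) * deriv (v t) r)
    (ψ : ℝ → ℝ → ℝ)
    (hψ : ∀ t r, ψ t r = arccos (Real.sqrt ((β - 1) / β) * cos (v t r))) :
    ∀ t ∈ Ioi (0:ℝ), ∀ r ∈ Ioi (0:ℝ),
      (ψ t r ∈ Ioo 0 π) ∧ (1 < β * sin (ψ t r) ^ 2) ∧
      deriv (fun s => ψ s r) t
        = deriv (deriv (ψ t)) r + (1/r) * deriv (ψ t) r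
          - (cos (ψ t r) / ((β * sin (ψ t r) ^ 2 - 1) * sin (ψ t r)))
              * (deriv (ψ t) r) ^ 2 := by
  have hβ0 : 0 < β := by linarith
  set k := Real.sqrt ((β - 1) / β)
  have hk2 : k ^ 2 = (β - 1) / β := Real.sq_sqrt (div_nonneg (by linarith) hβ0.le)
  have hβk : β * k ^ 2 = β - 1 := by rw [hk2]; field_simp
  have hk : k ^ 2 < 1 := by nlinarith
  intro t ht r hr
  have hψt : ψ t = fun y => arccos (k * cos (v t y)) := funext (hψ t)
  have hsmooth : ContDiffOn ℝ (⊤ : ℕ∞) (v t) (Ioi 0) :=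
    hv_smooth.comp (contDiff_const.prodMk contDiff_id).contDiffOn fun y hy => ⟨ht, hy⟩
  have hvr : ∀ y ∈ Ioi (0 : ℝ), HasDerivAt (v t) (deriv (v t) y) y := fun y hy =>
    ((hsmooth.contDiffAt (Ioi_mem_nhds hy)).differentiableAt (by simp)).hasDerivAt
  have hvrr : HasDerivAt (deriv (v t)) (deriv (deriv (v t)) r) r :=
    (((hsmooth.deriv_of_isOpen (m := 1) isOpen_Ioi (by norm_cast)).contDiffAt
      (Ioi_mem_nhds hr)).differentiableAt (by simp)).hasDerivAt
  have hvt : HasDerivAt (fun s => v s r) (deriv (fun s => v s r) t) t := by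
    have h : ContDiffOn ℝ (⊤ : ℕ∞) (fun s => v s r) (Ioi 0) :=
      hv_smooth.comp (contDiff_id.prodMk contDiff_const).contDiffOn fun y hy => ⟨hy, hr⟩
    exact ((h.contDiffAt (Ioi_mem_nhds ht)).differentiableAt (by simp)).hasDerivAt
  have hψ_t := (hasDerivAt_arccos_mul_cos hk hvt).deriv
  have hψ_r : ∀ y ∈ Ioi (0 : ℝ), deriv (ψ t) y
      = k * sin (v t y) / √(1 - (k * cos (v t y)) ^ 2) * deriv (v t) y := fun y hy => by
    rw [hψt]; exact (hasDerivAt_arccos_mul_cos hk (hvr y hy)).deriv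
  have hψ_rr := (((hasDerivAt_mul_sin_div_sqrt hk (hvr r hr)).fun_mul hvrr).congr_of_eventuallyEq
    (Filter.eventuallyEq_of_mem (Ioi_mem_nhds hr) hψ_r)).deriv
  have hpos := one_sub_mul_cos_sq_pos hk (v t r)
  have hlt : |k * cos (v t r)| < 1 := (sq_lt_one_iff_abs_lt_one _).1 (by linarith)
  have hsin : sin (ψ t r) = √(1 - (k * cos (v t r)) ^ 2) := by rw [hψ, sin_arccos]
  have hcos : cos (ψ t r) = k * cos (v t r) := by
    rw [hψ, cos_arccos (abs_lt.1 hlt).1.le (abs_lt.1 hlt).2.le]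
  have hS := Real.sqrt_pos.2 hpos
  have hSS := Real.sq_sqrt hpos.le
  have hv := sin_pos_of_mem_Ioo (hv_range t ht r hr)
  have hβS : β * √(1 - (k * cos (v t r)) ^ 2) ^ 2 - 1 = (β - 1) * sin (v t r) ^ 2 := by
    rw [hSS]
    linear_combination (-cos (v t r) ^ 2) * hβk - (β - 1) * sin_sq_add_cos_sq (v t r)
  refine ⟨?_, ?_, ?_⟩
  · rw [hψ]
    refine ⟨arccos_pos.2 (abs_lt.1 hlt).2, lt_of_le_of_ne (arccos_le_pi _) fun h => ?_⟩
    exact (arccos_eq_pi.1 h).not_gt (abs_lt.1 hlt).1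
  · rw [hsin]
    have : 0 < (β - 1) * sin (v t r) ^ 2 := mul_pos (by linarith) (pow_pos hv 2)
    linarith
  · simp only [hψ] at hψ_t ⊢
    rw [← hψ, hψ_t, hψ_rr, hψ_r r hr, hsin, hcos, hβS, hv_eq t ht r hr]
    have hβ1 : β - 1 ≠ 0 := by linarith
    have hr0 : r ≠ 0 := ne_of_gt hr
    set S := √(1 - (k * cos (v t r)) ^ 2)
    field_simp
    linear_combination k * r * deriv (v t) r ^ 2 * cos (v t r) * hβk
end

section
/- Let v₀ be the radial function on ℝ² with v₀(x) = ∫₀^{|x|} g(s) ds, where g(r) = 1/(r·((6k+2)³ − (6k+1)³)) for r ∈ (e^{(6k+1)³}, e^{(6k+2)³}], g(r) = −1/(r·((6k+5)³ − (6k+4)³)) for r ∈ (e^{(6k+4)³}, e^{(6k+5)³}], and g(r) = 0 otherwise (k ∈ ℕ, g = 0 on (0,e]). Let v(t,x) = ∫_{ℝ²} Γ(t, x − y) v₀(y) dy, and set t_k = e^{2(6k+3)³}, t̃_k = e^{2(6k+6)³}. Then lim_{k→∞} v(t_k, 0) = 1 and lim_{k→∞} v(t̃_k, 0) = 0; in particular,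 the oscillation sup_x v(t,x) − inf_x v(t,x) does not tend to 0 as t → ∞. -/
open Real Set MeasureTheory Filter

noncomputable section

/-- The radial derivative profile of the non-shrinking example:
`g(r) = 1/(r((6k+2)³−(6k+1)³))` on `(e^{(6k+1)³}, e^{(6k+2)³}]`,
`g(r) = −1/(r((6k+5)³−(6k+4)³))` on `(e^{(6k+4)³}, e^{(6k+5)³}]` (`k ∈ ℕ`),
and `g = 0` elsewhere (in particular on `(0, e]`). -/
def g (r : ℝ) : ℝ :=
  (∑' k : ℕ,
    (Ioc (Real.exp ((6*(k:ℝ)+1)^3)) (Real.exp ((6*(k:ℝ)+2)^3))).indicator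
      (fun ρ => 1 / (ρ * ((6*(k:ℝ)+2)^3 - (6*(k:ℝ)+1)^3))) r)
  - (∑' k : ℕ,
    (Ioc (Real.exp ((6*(k:ℝ)+4)^3)) (Real.exp ((6*(k:ℝ)+5)^3))).indicator
      (fun ρ => 1 / (ρ * ((6*(k:ℝ)+5)^3 - (6*(k:ℝ)+4)^3))) r)

/-- The two-dimensional heat kernel `Γ(t,z) = (4πt)⁻¹ e^{−|z|²/(4t)}`. -/
def heatKernel2 (t : ℝ) (z : EuclideanSpace ℝ (Fin 2)) : ℝ :=
  (4 * π * t)⁻¹ * Real.exp (-‖z‖ ^ 2 / (4 * t))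

/-- The profile `1/(ρ(b-a))` on `(e^a, e^b]`, of total mass one. -/
def logBump (a b : ℝ) : ℝ → ℝ :=
  (Ioc (Real.exp a) (Real.exp b)).indicator (fun ρ => 1 / (ρ * (b - a)))

lemma logBump_of_le {a b r : ℝ} (h : r ≤ Real.exp a) : logBump a b r = 0 :=
  indicator_of_notMem (fun hr => absurd hr.1 (not_lt.2 h)) _

lemma logBump_of_gt {a b r : ℝ} (h : Real.exp b < r) : logBump a b r = 0 :=
  indicator_of_notMem (fun hr => absurd hr.2 (not_le.2 h)) _

lemma logBump_nonneg {a b : ℝ} (h : a < b) (r : ℝ) : 0 ≤ logBump a b r := by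
  refine indicator_nonneg (fun ρ hρ => ?_) r
  have h1 : 0 < ρ := (Real.exp_pos a).trans hρ.1
  have h2 : 0 < b - a := sub_pos.2 h
  positivity

lemma integrable_logBump {a b : ℝ} (h : a < b) : Integrable (logBump a b) := by
  refine (integrable_indicator_iff measurableSet_Ioc).2 ?_
  refine (ContinuousOn.integrableOn_Icc ?_).mono_set Ioc_subset_Icc_self
  refine ContinuousOn.div (by fun_prop) (by fun_prop) fun ρ hρ => ?_
  have h1 : 0 < ρ := (Real.exp_pos a).trans_le hρ.1
  have h2 : 0 < b - a := sub_pos.2 h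
  positivity

/-- The primitive of `logBump a b` vanishing at the origin. -/
def logStep (a b r : ℝ) : ℝ := ∫ s in (0:ℝ)..r, logBump a b s

lemma logStep_of_le {a b r : ℝ} (h : r ≤ Real.exp a) : logStep a b r = 0 := by
  refine intervalIntegral.integral_zero_ae (Eventually.of_forall fun s hs => ?_)
  refine logBump_of_le (hs.2.trans (max_le (Real.exp_pos a).le h))

lemma logStep_mono {a b : ℝ} (h : a < b) : Monotone (logStep a b) := by
  intro r s hrs
  have hi (x y : ℝ) : IntervalIntegrable (logBump a b) volume x y :=
    (integrable_logBump h).intervalIntegrable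
  have := intervalIntegral.integral_add_adjacent_intervals (hi 0 r) (hi r s)
  have h0 : 0 ≤ ∫ x in r..s, logBump a b x :=
    intervalIntegral.integral_nonneg hrs fun x _ => logBump_nonneg h x
  simp only [logStep]
  linarith

lemma logStep_of_ge {a b r : ℝ} (h : a < b) (hr : Real.exp b ≤ r) : logStep a b r = 1 := by
  have hab : Real.exp a < Real.exp b := Real.exp_lt_exp.2 h
  have hr0 : 0 ≤ r := (Real.exp_pos b).le.trans hr
  have hsub : Ioc (Real.exp a) (Real.exp b) ⊆ Ioc 0 r :=
    Ioc_subset_Ioc (Real.exp_pos a).le hr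
  have hba : b - a ≠ 0 := (sub_pos.2 h).ne'
  rw [logStep, intervalIntegral.integral_of_le hr0, logBump,
    setIntegral_indicator measurableSet_Ioc, inter_eq_right.2 hsub,
    ← intervalIntegral.integral_of_le hab.le]
  have : ∀ ρ : ℝ, 1 / (ρ * (b - a)) = (1 / ρ) * (b - a)⁻¹ := fun ρ => by
    rw [one_div, one_div, mul_inv]
  simp only [this]
  rw [intervalIntegral.integral_mul_const,
    integral_one_div_of_pos (Real.exp_pos a) (Real.exp_pos b), ← Real.exp_sub, Real.log_exp,
    mul_inv_cancel₀ hba]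

lemma logStep_mem_Icc {a b : ℝ} (h : a < b) (r : ℝ) : logStep a b r ∈ Icc (0:ℝ) 1 := by
  constructor
  · rw [← logStep_of_le (b := b) (min_le_right r (Real.exp a))]
    exact logStep_mono h (min_le_left _ _)
  · rw [← logStep_of_ge h (le_max_right r (Real.exp b))]
    exact logStep_mono h (le_max_left _ _)

lemma exp_cube_le {x y : ℝ} (hx : 0 ≤ x) (hxy : x ≤ y) : Real.exp (x ^ 3) ≤ Real.exp (y ^ 3) :=
  Real.exp_le_exp.2 (pow_le_pow_left₀ hx hxy 3)

lemma cube_lt {x y : ℝ} (hx : 0 ≤ x) (hxy : x < y) : x ^ 3 < y ^ 3 :=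
  pow_lt_pow_left₀ hxy hx (by norm_num)

lemma up_lt (k : ℕ) : (6*(k:ℝ)+1)^3 < (6*(k:ℝ)+2)^3 := cube_lt (by positivity) (by linarith)

lemma down_lt (k : ℕ) : (6*(k:ℝ)+4)^3 < (6*(k:ℝ)+5)^3 := cube_lt (by positivity) (by linarith)

lemma g_eq_sum {N : ℕ} {r : ℝ} (hr : r ≤ Real.exp ((6*(N:ℝ)+1)^3)) :
    g r = (∑ k ∈ Finset.range N, logBump ((6*(k:ℝ)+1)^3) ((6*(k:ℝ)+2)^3) r)
      - ∑ k ∈ Finset.range N, logBump ((6*(k:ℝ)+4)^3) ((6*(k:ℝ)+5)^3) r := by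
  have key (k : ℕ) (hk : k ∉ Finset.range N) : (N:ℝ) ≤ k := by
    exact_mod_cast not_lt.1 (fun h => hk (Finset.mem_range.2 h))
  rw [g]
  congr 1
  · refine tsum_eq_sum fun k hk => logBump_of_le (hr.trans (exp_cube_le (by positivity) ?_))
    linarith [key k hk]
  · refine tsum_eq_sum fun k hk => logBump_of_le (hr.trans (exp_cube_le (by positivity) ?_))
    linarith [key k hk]

lemma exists_le_exp_cube (r : ℝ) : ∃ N : ℕ, r ≤ Real.exp ((6*(N:ℝ)+1)^3) := by
  obtain ⟨N, hN⟩ := exists_nat_ge r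
  refine ⟨N, hN.trans ?_⟩
  have h0 : (0:ℝ) ≤ N := N.cast_nonneg
  have h1 : 6*(N:ℝ)+1 ≤ (6*(N:ℝ)+1)^3 := le_self_pow₀ (by linarith) (by norm_num)
  linarith [Real.add_one_le_exp ((6*(N:ℝ)+1)^3)]

lemma intervalIntegrable_g (x y : ℝ) : IntervalIntegrable g volume x y := by
  obtain ⟨N, hN⟩ := exists_le_exp_cube (max x y)
  have h : Integrable (fun r =>
      (∑ k ∈ Finset.range N, logBump ((6*(k:ℝ)+1)^3) ((6*(k:ℝ)+2)^3) r)
      - ∑ k ∈ Finset.range N, logBump ((6*(k:ℝ)+4)^3) ((6*(k:ℝ)+5)^3) r) :=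
    (integrable_finsetSum _ fun k _ => integrable_logBump (up_lt k)).sub
      (integrable_finsetSum _ fun k _ => integrable_logBump (down_lt k))
  refine (h.intervalIntegrable (a := x) (b := y)).congr fun r hr => ?_
  exact (g_eq_sum (hr.2.trans hN)).symm

lemma integral_g_eq_sum {N : ℕ} {r : ℝ} (hr : r ≤ Real.exp ((6*(N:ℝ)+1)^3)) :
    ∫ s in (0:ℝ)..r, g s =
      (∑ k ∈ Finset.range N, logStep ((6*(k:ℝ)+1)^3) ((6*(k:ℝ)+2)^3) r)
      - ∑ k ∈ Finset.range N, logStep ((6*(k:ℝ)+4)^3) ((6*(k:ℝ)+5)^3) r := by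
  have hup (k : ℕ) := (integrable_logBump (up_lt k)).intervalIntegrable (a := 0) (b := r)
  have hdown (k : ℕ) := (integrable_logBump (down_lt k)).intervalIntegrable (a := 0) (b := r)
  have hsup := IntervalIntegrable.sum (Finset.range N) fun k _ => hup k
  have hsdown := IntervalIntegrable.sum (Finset.range N) fun k _ => hdown k
  simp only [logStep]
  rw [← intervalIntegral.integral_finsetSum fun k _ => hup k,
    ← intervalIntegral.integral_finsetSum fun k _ => hdown k,
    ← intervalIntegral.integral_sub (by simpa [Finset.sum_fn] using hsup)
      (by simpa [Finset.sum_fn] using hsdown)]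
  refine intervalIntegral.integral_congr_ae (Eventually.of_forall fun s hs => ?_)
  exact g_eq_sum (hs.2.trans (max_le (Real.exp_pos _).le hr))

lemma integral_g_of_le {r : ℝ} (hr : r ≤ Real.exp 1) : ∫ s in (0:ℝ)..r, g s = 0 := by
  rw [integral_g_eq_sum (N := 0) (by simpa using hr)]
  simp

lemma integral_g_eq {m : ℕ} {r : ℝ} (h1 : Real.exp ((6*(m:ℝ)+1)^3) ≤ r)
    (h2 : r ≤ Real.exp ((6*(m:ℝ)+7)^3)) :
    ∫ s in (0:ℝ)..r, g s = logStep ((6*(m:ℝ)+1)^3) ((6*(m:ℝ)+2)^3) r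
      - logStep ((6*(m:ℝ)+4)^3) ((6*(m:ℝ)+5)^3) r := by
  have hcast : 6*((m+1 : ℕ):ℝ)+1 = 6*(m:ℝ)+7 := by push_cast; ring
  have hle (k : ℕ) (hk : k ∈ Finset.range m) : (k:ℝ) + 1 ≤ m := by
    exact_mod_cast Finset.mem_range.1 hk
  rw [integral_g_eq_sum (N := m + 1) (by rwa [hcast]), Finset.sum_range_succ,
    Finset.sum_range_succ,
    Finset.sum_congr rfl (fun k hk => logStep_of_ge (up_lt k)
      ((exp_cube_le (by positivity) (by linarith [hle k hk])).trans h1)),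
    Finset.sum_congr rfl (fun k hk => logStep_of_ge (down_lt k)
      ((exp_cube_le (by positivity) (by linarith [hle k hk])).trans h1))]
  ring

lemma integral_g_mem_Icc (r : ℝ) : ∫ s in (0:ℝ)..r, g s ∈ Icc (0:ℝ) 1 := by
  rcases le_or_gt r (Real.exp 1) with hr | hr
  · simp [integral_g_of_le hr]
  obtain ⟨m, h1, h2⟩ : ∃ m : ℕ, Real.exp ((6*(m:ℝ)+1)^3) ≤ r ∧ r ≤ Real.exp ((6*(m:ℝ)+7)^3) := by
    classical
    have hex := exists_le_exp_cube r
    obtain ⟨m, hm⟩ : ∃ m, Nat.find hex = m + 1 := by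
      refine Nat.exists_eq_succ_of_ne_zero fun h0 => ?_
      have := Nat.find_spec hex
      rw [h0] at this
      norm_num at this
      linarith
    refine ⟨m, (not_le.1 (Nat.find_min hex (by omega))).le, ?_⟩
    have := Nat.find_spec hex
    rw [hm] at this
    convert this using 3
    push_cast
    ring
  rw [integral_g_eq h1 h2]
  have hu := logStep_mem_Icc (up_lt m) r
  have hd := logStep_mem_Icc (down_lt m) r
  rcases le_total r (Real.exp ((6*(m:ℝ)+4)^3)) with h | h
  · rwa [logStep_of_le h, sub_zero]
  · rw [logStep_of_ge (up_lt m) ((exp_cube_le (by positivity) (by linarith)).trans h)]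
    exact ⟨by linarith [hd.2], by linarith [hd.1]⟩

lemma integral_g_eq_one {m : ℕ} {r : ℝ} (h1 : Real.exp ((6*(m:ℝ)+2)^3) ≤ r)
    (h2 : r ≤ Real.exp ((6*(m:ℝ)+4)^3)) : ∫ s in (0:ℝ)..r, g s = 1 := by
  rw [integral_g_eq ((exp_cube_le (by positivity) (by linarith)).trans h1)
    (h2.trans (exp_cube_le (by positivity) (by linarith))), logStep_of_ge (up_lt m) h1,
    logStep_of_le h2, sub_zero]

lemma integral_g_eq_zero {m : ℕ} {r : ℝ} (h1 : Real.exp ((6*(m:ℝ)+5)^3) ≤ r)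
    (h2 : r ≤ Real.exp ((6*(m:ℝ)+7)^3)) : ∫ s in (0:ℝ)..r, g s = 0 := by
  rw [integral_g_eq ((exp_cube_le (by positivity) (by linarith)).trans h1) h2,
    logStep_of_ge (up_lt m) ((exp_cube_le (by positivity) (by linarith)).trans h1),
    logStep_of_ge (down_lt m) h1, sub_self]

lemma eventually_mem_exp_cube_window {p c C : ℝ} (hp : 1 ≤ p) (hc : 0 < c) {r : ℕ → ℝ}
    (hr : ∀ᶠ k : ℕ in atTop, c * Real.exp ((6*(k:ℝ)+p)^3) ≤ r k ∧
      r k ≤ C * Real.exp ((6*(k:ℝ)+p)^3)) :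
    ∀ᶠ k : ℕ in atTop, Real.exp ((6*(k:ℝ)+(p-1))^3) ≤ r k ∧
      r k ≤ Real.exp ((6*(k:ℝ)+(p+1))^3) := by
  filter_upwards [hr, tendsto_natCast_atTop_atTop.eventually_ge_atTop (-Real.log c),
    tendsto_natCast_atTop_atTop.eventually_ge_atTop C] with k hk hkc hkC
  have h0 : (0:ℝ) ≤ k := k.cast_nonneg
  constructor
  · refine le_trans ?_ hk.1
    rw [← Real.exp_log hc, ← Real.exp_add, Real.exp_le_exp]
    nlinarith [mul_nonneg h0 h0, mul_nonneg h0 (sub_nonneg.2 hp), sq_nonneg (p - 1)]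
  · refine hk.2.trans ?_
    have hC : C ≤ Real.exp k := hkC.trans (by linarith [Real.add_one_le_exp (k:ℝ)])
    refine (mul_le_mul_of_nonneg_right hC (Real.exp_pos _).le).trans ?_
    rw [← Real.exp_add, Real.exp_le_exp]
    nlinarith [mul_nonneg h0 h0, mul_nonneg h0 (sub_nonneg.2 hp), sq_nonneg (p - 1)]

lemma tendsto_integral_g_one {c C : ℝ} (hc : 0 < c) {r : ℕ → ℝ}
    (hr : ∀ᶠ k : ℕ in atTop, c * Real.exp ((6*(k:ℝ)+3)^3) ≤ r k ∧
      r k ≤ C * Real.exp ((6*(k:ℝ)+3)^3)) :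
    Tendsto (fun k => ∫ s in (0:ℝ)..r k, g s) atTop (nhds 1) := by
  refine tendsto_const_nhds.congr' ?_
  filter_upwards [eventually_mem_exp_cube_window (by norm_num) hc hr] with k hk
  norm_num at hk
  exact (integral_g_eq_one hk.1 hk.2).symm

lemma tendsto_integral_g_zero {c C : ℝ} (hc : 0 < c) {r : ℕ → ℝ}
    (hr : ∀ᶠ k : ℕ in atTop, c * Real.exp ((6*(k:ℝ)+6)^3) ≤ r k ∧
      r k ≤ C * Real.exp ((6*(k:ℝ)+6)^3)) :
    Tendsto (fun k => ∫ s in (0:ℝ)..r k, g s) atTop (nhds 0) := by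
  refine tendsto_const_nhds.congr' ?_
  filter_upwards [eventually_mem_exp_cube_window (by norm_num) hc hr] with k hk
  norm_num at hk
  exact (integral_g_eq_zero hk.1 hk.2).symm

lemma heatKernel2_nonneg {t : ℝ} (ht : 0 ≤ t) (z : EuclideanSpace ℝ (Fin 2)) :
    0 ≤ heatKernel2 t z := by
  unfold heatKernel2
  positivity

lemma heatKernel2_one (z : EuclideanSpace ℝ (Fin 2)) :
    heatKernel2 1 z = (4 * π)⁻¹ * Real.exp (-(1/4) * ‖z‖ ^ 2) := by
  rw [heatKernel2, mul_one, mul_one]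
  congr 2
  ring

lemma integral_heatKernel2_one : ∫ z, heatKernel2 1 z = 1 := by
  simp only [heatKernel2_one]
  rw [integral_const_mul, GaussianFourier.integral_rexp_neg_mul_sq_norm (by norm_num)]
  simp
  field_simp

lemma integrable_heatKernel2_one : Integrable (heatKernel2 1) := by
  by_contra h
  have := integral_heatKernel2_one
  rw [integral_undef h] at this
  exact zero_ne_one this

lemma heatKernel2_smul {s : ℝ} (hs : 0 < s) (z : EuclideanSpace ℝ (Fin 2)) :
    heatKernel2 (s ^ 2) (s • z) = (s ^ 2)⁻¹ * heatKernel2 1 z := by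
  rw [heatKernel2, heatKernel2, norm_smul, Real.norm_of_nonneg hs.le]
  have : -(s * ‖z‖) ^ 2 / (4 * s ^ 2) = -‖z‖ ^ 2 / (4 * 1) := by
    field_simp
  rw [this]
  field_simp

lemma integral_heatKernel2_mul (f : EuclideanSpace ℝ (Fin 2) → ℝ) {s : ℝ} (hs : 0 < s)
    (x : EuclideanSpace ℝ (Fin 2)) :
    ∫ y, heatKernel2 (s ^ 2) (x - y) * f y = ∫ z, heatKernel2 1 z * f (x - s • z) := by
  rw [← integral_sub_left_eq_self _ volume x]
  simp only [sub_sub_cancel]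
  have h := Measure.integral_comp_smul (volume : Measure (EuclideanSpace ℝ (Fin 2)))
    (fun w => heatKernel2 (s ^ 2) w * f (x - w)) s
  simp only [heatKernel2_smul hs, mul_assoc, integral_const_mul, finrank_euclideanSpace,
    Fintype.card_fin, smul_eq_mul] at h
  rw [abs_of_pos (by positivity)] at h
  exact (mul_left_cancel₀ (by positivity) h).symm

/-- Dominated convergence for heat averages of a measurable function with values in `[0,1]`. -/
lemma tendsto_heat_average {f : EuclideanSpace ℝ (Fin 2) → ℝ} (hf : Measurable f)
    (hf01 : ∀ x, f x ∈ Icc (0:ℝ) 1) {s : ℕ → ℝ} (hs : ∀ k, 0 < s k)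
    {x : ℕ → EuclideanSpace ℝ (Fin 2)} {c : ℝ}
    (h : ∀ z ≠ 0, Tendsto (fun k => f (x k - s k • z)) atTop (nhds c)) :
    Tendsto (fun k => ∫ y, heatKernel2 (s k ^ 2) (x k - y) * f y) atTop (nhds c) := by
  simp only [fun k => integral_heatKernel2_mul f (hs k) (x k)]
  have hc : c = ∫ z, heatKernel2 1 z * c := by
    rw [integral_mul_const, integral_heatKernel2_one, one_mul]
  rw [hc]
  refine tendsto_integral_of_dominated_convergence (heatKernel2 1) (fun k => ?_)
    integrable_heatKernel2_one (fun k => Eventually.of_forall fun z => ?_) ?_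
  · exact integrable_heatKernel2_one.aestronglyMeasurable.mul
      (hf.comp (by fun_prop)).aestronglyMeasurable
  · have h0 := heatKernel2_nonneg zero_le_one z
    rw [Real.norm_of_nonneg (mul_nonneg h0 (hf01 _).1)]
    exact mul_le_of_le_one_right h0 (hf01 _).2
  · have hne : ∀ᵐ z : EuclideanSpace ℝ (Fin 2), z ≠ 0 := by
      simp [ae_iff]
    filter_upwards [hne] with z hz
    exact (h z hz).const_mul _

lemma heat_average_mem_Icc {f : EuclideanSpace ℝ (Fin 2) → ℝ}
    (hf01 : ∀ x, f x ∈ Icc (0:ℝ) 1) {s : ℝ} (hs : 0 < s) (x : EuclideanSpace ℝ (Fin 2)) :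
    ∫ y, heatKernel2 (s ^ 2) (x - y) * f y ∈ Icc (0:ℝ) 1 := by
  rw [integral_heatKernel2_mul f hs]
  have h0 := heatKernel2_nonneg zero_le_one
  have hle (z : EuclideanSpace ℝ (Fin 2)) : heatKernel2 1 z * f (x - s • z) ≤ heatKernel2 1 z :=
    mul_le_of_le_one_right (h0 z) (hf01 _).2
  refine ⟨integral_nonneg fun z => mul_nonneg (h0 z) (hf01 _).1, ?_⟩
  refine le_trans ?_ integral_heatKernel2_one.le
  exact integral_mono_of_nonneg (Eventually.of_forall fun z => mul_nonneg (h0 z) (hf01 _).1)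
    integrable_heatKernel2_one (Eventually.of_forall hle)

lemma eventually_norm_sub_bounds {p : ℝ} (hp : 0 ≤ p) {x : ℕ → EuclideanSpace ℝ (Fin 2)}
    (hx : ∀ k, ‖x k‖ = Real.exp ((6*(k:ℝ)+p)^3)) (w : EuclideanSpace ℝ (Fin 2)) :
    ∀ᶠ k : ℕ in atTop, 1 / 2 * Real.exp ((6*(k:ℝ)+p)^3) ≤ ‖x k - w‖ ∧
      ‖x k - w‖ ≤ 2 * Real.exp ((6*(k:ℝ)+p)^3) := by
  filter_upwards [tendsto_natCast_atTop_atTop.eventually_ge_atTop (2 * ‖w‖),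
    eventually_ge_atTop 1] with k hk hk1
  have h1 : (1:ℝ) ≤ k := by exact_mod_cast hk1
  have h2 : 6*(k:ℝ)+p ≤ (6*(k:ℝ)+p)^3 := le_self_pow₀ (by linarith) (by norm_num)
  have h3 := Real.add_one_le_exp ((6*(k:ℝ)+p)^3)
  have h4 := norm_sub_norm_le (x k) w
  have h5 := norm_sub_le (x k) w
  rw [hx] at h4 h5
  have h6 := norm_nonneg w
  constructor <;> linarith

lemma exp_two_mul_eq_sq (a : ℝ) : Real.exp (2 * a) = Real.exp a ^ 2 := by
  rw [← Real.exp_nat_mul]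
  norm_num

/-- For the radial initial datum `v₀(x) = ∫₀^{|x|} g(s) ds`
and its heat extension `v`, along `t_k = e^{2(6k+3)³}` and `t̃_k = e^{2(6k+6)³}`
one has `v(t_k,0) → 1` and `v(t̃_k,0) → 0`; in particular the oscillation of
`v(t,·)` does not tend to `0` as `t → ∞`. -/
theorem heat_extension_does_not_shrink
    (v₀ : EuclideanSpace ℝ (Fin 2) → ℝ)
    (hv₀ : ∀ x, v₀ x = ∫ s in (0:ℝ)..‖x‖, g s)
    (v : ℝ → EuclideanSpace ℝ (Fin 2) → ℝ)
    (hv : ∀ t x, v t x = ∫ y, heatKernel2 t (x - y) * v₀ y) :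
    Tendsto (fun k : ℕ => v (Real.exp (2 * (6*(k:ℝ)+3)^3)) 0) atTop (nhds 1) ∧
    Tendsto (fun k : ℕ => v (Real.exp (2 * (6*(k:ℝ)+6)^3)) 0) atTop (nhds 0) ∧
    ¬ Tendsto (fun t : ℝ => (⨆ x, v t x) - (⨅ x, v t x)) atTop (nhds 0) := by
  have hv₀' : v₀ = fun x => ∫ s in (0:ℝ)..‖x‖, g s := funext hv₀
  have hmeas : Measurable v₀ := by
    rw [hv₀']
    exact ((intervalIntegral.continuous_primitive intervalIntegrable_g 0).comp
      continuous_norm).measurable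
  have h01 (x) : v₀ x ∈ Icc (0:ℝ) 1 := hv₀ x ▸ integral_g_mem_Icc _
  have hnorm (k : ℕ) (p : ℝ) (z : EuclideanSpace ℝ (Fin 2)) :
      ‖(0 : EuclideanSpace ℝ (Fin 2)) - Real.exp ((6*(k:ℝ)+p)^3) • z‖
        = ‖z‖ * Real.exp ((6*(k:ℝ)+p)^3) := by
    rw [zero_sub, norm_neg, norm_smul, Real.norm_of_nonneg (Real.exp_pos _).le, mul_comm]
  refine ⟨?_, ?_, fun hosc => ?_⟩
  · simp only [hv, exp_two_mul_eq_sq]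
    refine tendsto_heat_average hmeas h01 (fun k => Real.exp_pos _) fun z hz => ?_
    simp only [hv₀]
    exact tendsto_integral_g_one (norm_pos_iff.2 hz)
      (Eventually.of_forall fun k => ⟨(hnorm k 3 z).ge, (hnorm k 3 z).le⟩)
  · simp only [hv, exp_two_mul_eq_sq]
    refine tendsto_heat_average hmeas h01 (fun k => Real.exp_pos _) fun z hz => ?_
    simp only [hv₀]
    exact tendsto_integral_g_zero (norm_pos_iff.2 hz)
      (Eventually.of_forall fun k => ⟨(hnorm k 6 z).ge, (hnorm k 6 z).le⟩)
  · obtain ⟨e, he⟩ : ∃ e : EuclideanSpace ℝ (Fin 2), ‖e‖ = 1 :=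
      ⟨EuclideanSpace.single 0 1, by simp⟩
    have hx (p : ℝ) (k : ℕ) : ‖Real.exp ((6*(k:ℝ)+p)^3) • e‖ = Real.exp ((6*(k:ℝ)+p)^3) := by
      rw [norm_smul, he, mul_one, Real.norm_of_nonneg (Real.exp_pos _).le]
    have hge : ∀ᶠ t : ℝ in atTop, 1 ≤ (⨆ x, v t x) - (⨅ x, v t x) := by
      filter_upwards [eventually_gt_atTop 0] with t ht
      have hs : 0 < √t := Real.sqrt_pos.2 ht
      have hvt (x) : v t x = ∫ y, heatKernel2 (√t ^ 2) (x - y) * v₀ y := by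
        rw [hv, Real.sq_sqrt ht.le]
      have hvt01 (x) : v t x ∈ Icc (0:ℝ) 1 := hvt x ▸ heat_average_mem_Icc h01 hs x
      have h1 : Tendsto (fun k : ℕ => v t (Real.exp ((6*(k:ℝ)+3)^3) • e)) atTop (nhds 1) := by
        simp only [hvt]
        refine tendsto_heat_average hmeas h01 (fun _ => hs) fun z _ => ?_
        simp only [hv₀]
        exact tendsto_integral_g_one (by norm_num)
          (eventually_norm_sub_bounds (by norm_num) (hx 3) (√t • z))
      have h0 : Tendsto (fun k : ℕ => v t (Real.exp ((6*(k:ℝ)+6)^3) • e)) atTop (nhds 0) := by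
        simp only [hvt]
        refine tendsto_heat_average hmeas h01 (fun _ => hs) fun z _ => ?_
        simp only [hv₀]
        exact tendsto_integral_g_zero (by norm_num)
          (eventually_norm_sub_bounds (by norm_num) (hx 6) (√t • z))
      have hsup : 1 ≤ ⨆ x, v t x := le_of_tendsto' h1 fun k =>
        le_ciSup (f := v t) ⟨1, forall_mem_range.2 fun x => (hvt01 x).2⟩ _
      have hinf : ⨅ x, v t x ≤ 0 := ge_of_tendsto' h0 fun k =>
        ciInf_le (f := v t) ⟨0, forall_mem_range.2 fun x => (hvt01 x).1⟩ _
      linarith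
    exact absurd (ge_of_tendsto hosc hge) (by norm_num)

end
end
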